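/- arXiv:1211.4346 — 2 statements merged into one kernel-verified Lean document; each statement's English description precedes it below -/
import Mathlib

section
/- Let A ∈ 𝓑. If the invariance value function u(·;A) is not identically zero, i.e. there exists x₀ ∈ X with u(x₀;A) > 0, then sup_{x∈X} u(x;A) = 1. -/
open MeasureTheory ProbabilityTheory

variable {X : Type*} [MeasurableSpace X]

/-- Transition operator: `(Pf)(x) = ∫ f(y) P(x,dy)`. -/
noncomputable def transOp (P : Kernel X X) (f : X → ℝ) : X → ℝ :=
  fun x => ∫ y, f y ∂(P x)

/-- Invariance operator `I_A f = 1_A · (Pf)`. -/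
noncomputable def invOp (P : Kernel X X) (A : Set X) (f : X → ℝ) : X → ℝ :=
  A.indicator (transOp P f)

/-- Invariance value functions `u_n(·;A)`. -/
noncomputable def uN (P : Kernel X X) (A : Set X) : ℕ → X → ℝ
  | 0 => A.indicator 1
  | n + 1 => invOp P A (uN P A n)

/-- `u(x;A) = lim_n u_n(x;A)` (the sequence is pointwise nonincreasing). -/
noncomputable def uFun (P : Kernel X X) (A : Set X) : X → ℝ :=
  fun x => ⨅ n, uN P A n x

/-- Reach-avoid value functions `w_n(·;A,B)`. -/
noncomputable def wN (P : Kernel X X) (A B : Set X) : ℕ → X → ℝ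
  | 0 => B.indicator 1
  | n + 1 => fun x => B.indicator 1 x + invOp P (A \ B) (wN P A B n) x

/-- `w(x;A,B) = lim_n w_n(x;A,B)` (the sequence is pointwise nondecreasing, in `[0,1]`). -/
noncomputable def wFun (P : Kernel X X) (A B : Set X) : X → ℝ :=
  fun x => ⨆ n, wN P A B n x

/-- A bounded function. -/
def BddFun (f : X → ℝ) : Prop := ∃ C : ℝ, ∀ x, |f x| ≤ C

/-- A set `S` is absorbing if `P(x,S) = 1` for all `x ∈ S`. -/
def Absorbing (P : Kernel X X) (S : Set X) : Prop := ∀ x ∈ S, P x S = 1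

/-- A set is simple if its only absorbing measurable subset is empty. -/
def Simple (P : Kernel X X) (A : Set X) : Prop :=
  ∀ S ⊆ A, MeasurableSet S → Absorbing P S → S = ∅


theorem measurable_uN (P : Kernel X X) {A : Set X} (hA : MeasurableSet A) (n : ℕ) :
    Measurable (uN P A n) := by
  induction n with
  | zero => exact measurable_one.indicator hA
  | succ n ih =>
    exact (StronglyMeasurable.integral_kernel ih.stronglyMeasurable).measurable.indicator hA

theorem uN_mem_Icc (P : Kernel X X) [IsMarkovKernel P] (A : Set X) (n : ℕ) (x : X) :
    uN P A n x ∈ Set.Icc (0 : ℝ) 1 := by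
  induction n generalizing x with
  | zero => by_cases hx : x ∈ A <;> simp [uN, hx]
  | succ n ih =>
    by_cases hx : x ∈ A
    · simp only [uN, invOp, Set.indicator_of_mem hx, transOp]
      refine ⟨integral_nonneg fun y => (ih y).1, ?_⟩
      have h := integral_mono_of_nonneg (μ := P x) (Filter.Eventually.of_forall fun y => (ih y).1)
        (integrable_const (1 : ℝ)) (Filter.Eventually.of_forall fun y => (ih y).2)
      simpa using h
    · simp [uN, invOp, hx]

theorem integrable_uN (P : Kernel X X) [IsMarkovKernel P] {A : Set X} (hA : MeasurableSet A)
    (n : ℕ) (μ : Measure X) [IsFiniteMeasure μ] : Integrable (uN P A n) μ :=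
  Integrable.of_mem_Icc 0 1 (measurable_uN P hA n).aemeasurable
    (Filter.Eventually.of_forall (uN_mem_Icc P A n))

theorem antitone_uN (P : Kernel X X) [IsMarkovKernel P] {A : Set X} (hA : MeasurableSet A) :
    Antitone (uN P A) := by
  refine antitone_nat_of_succ_le fun n => ?_
  induction n with
  | zero =>
    intro x
    by_cases hx : x ∈ A
    · simpa [uN, hx] using (uN_mem_Icc P A 1 x).2
    · simp [uN, invOp, hx]
  | succ n ih =>
    exact Set.indicator_mono fun x =>
      integral_mono (integrable_uN P hA (n + 1) _) (integrable_uN P hA n _) ih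

theorem bddBelow_range_uN (P : Kernel X X) [IsMarkovKernel P] (A : Set X) (x : X) :
    BddBelow (Set.range fun n => uN P A n x) :=
  ⟨0, Set.forall_mem_range.2 fun n => (uN_mem_Icc P A n x).1⟩

theorem uFun_le_uN (P : Kernel X X) [IsMarkovKernel P] (A : Set X) (n : ℕ) (x : X) :
    uFun P A x ≤ uN P A n x :=
  ciInf_le (bddBelow_range_uN P A x) n

theorem uFun_nonneg (P : Kernel X X) [IsMarkovKernel P] (A : Set X) (x : X) :
    0 ≤ uFun P A x :=
  le_ciInf fun n => (uN_mem_Icc P A n x).1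

theorem uFun_le_one (P : Kernel X X) [IsMarkovKernel P] (A : Set X) (x : X) :
    uFun P A x ≤ 1 :=
  (uFun_le_uN P A 0 x).trans (uN_mem_Icc P A 0 x).2

theorem tendsto_uN (P : Kernel X X) [IsMarkovKernel P] {A : Set X} (hA : MeasurableSet A)
    (x : X) : Filter.Tendsto (fun n => uN P A n x) Filter.atTop (nhds (uFun P A x)) :=
  tendsto_atTop_ciInf (fun _ _ h => antitone_uN P hA h x) (bddBelow_range_uN P A x)

/-- The limit `u(·;A)` is a fixed point of the invariance operator. -/
theorem invOp_uFun (P : Kernel X X) [IsMarkovKernel P] {A : Set X} (hA : MeasurableSet A) :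
    invOp P A (uFun P A) = uFun P A := by
  funext x
  refine tendsto_nhds_unique ?_ ((Filter.tendsto_add_atTop_iff_nat 1).2 (tendsto_uN P hA x))
  by_cases hx : x ∈ A
  · simp only [uN, invOp, Set.indicator_of_mem hx, transOp]
    refine tendsto_integral_of_dominated_convergence (fun _ => (1 : ℝ))
      (fun n => (measurable_uN P hA n).aestronglyMeasurable) (integrable_const _) (fun n => ?_)
      (Filter.Eventually.of_forall (tendsto_uN P hA))
    refine Filter.Eventually.of_forall fun y => ?_
    rw [Real.norm_of_nonneg (uN_mem_Icc P A n y).1]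
    exact (uN_mem_Icc P A n y).2
  · simp [uN, invOp, hx]

/-- A uniform bound `u ≤ c` improves to `u ≤ c · u_n` for every `n`. -/
theorem uFun_le_mul_uN (P : Kernel X X) [IsMarkovKernel P] {A : Set X} (hA : MeasurableSet A)
    {c : ℝ} (hc : ∀ x, uFun P A x ≤ c) (n : ℕ) (x : X) :
    uFun P A x ≤ c * uN P A n x := by
  induction n generalizing x with
  | zero =>
    by_cases hx : x ∈ A
    · simpa [uN, hx] using hc x
    · simpa [uN, hx] using uFun_le_uN P A 0 x
  | succ n ih =>
    rw [← invOp_uFun P hA]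
    by_cases hx : x ∈ A
    · simp only [uN, invOp, Set.indicator_of_mem hx, transOp]
      rw [← integral_const_mul]
      exact integral_mono_of_nonneg (Filter.Eventually.of_forall (uFun_nonneg P A))
        ((integrable_uN P hA n _).const_mul c) (Filter.Eventually.of_forall ih)
    · simp [uN, invOp, hx]

/-- if the invariance value function `u(·;A)` is not identically zero,
then `sup_x u(x;A) = 1`. -/
theorem stmt8 (P : Kernel X X) [IsMarkovKernel P] (A : Set X) (hA : MeasurableSet A)
    (hnz : ∃ x₀ : X, 0 < uFun P A x₀) :
    (⨆ x, uFun P A x) = 1 := by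
  obtain ⟨x₀, hx₀⟩ := hnz
  have : Nonempty X := ⟨x₀⟩
  have hbdd : BddAbove (Set.range (uFun P A)) :=
    ⟨1, Set.forall_mem_range.2 (uFun_le_one P A)⟩
  refine le_antisymm (ciSup_le (uFun_le_one P A)) ?_
  have hle : uFun P A x₀ ≤ (⨆ x, uFun P A x) * uFun P A x₀ :=
    ge_of_tendsto' ((tendsto_uN P hA x₀).const_mul _)
      fun n => uFun_le_mul_uN P hA (le_ciSup hbdd) n x₀
  exact (le_mul_iff_one_le_left hx₀).1 hle
end

section
/- Let X be a countable set with the discrete σ-algebra and let P be a Markov kernel on X. Let A ⊆ X be a finite set. Then: (a) if m(A) < ∞ then m(A) ≤ card(A); (b) consequently, if sup_{i∈X} u_{card(A)+1}(i;A) = 1, then m(A) = ∞ and l.a.s.(A) = {i ∈ X : u_{card(A)+1}(i;A) = 1}. -/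
open MeasureTheory ProbabilityTheory

variable {X : Type*} [MeasurableSpace X]

lemma uN_nonneg (P : Kernel X X) (A : Set X) (n : ℕ) (x : X) : 0 ≤ uN P A n x := by
  induction n generalizing x with
  | zero => exact Set.indicator_nonneg (fun _ _ => zero_le_one) x
  | succ n ih => exact Set.indicator_nonneg (fun _ _ => integral_nonneg ih) x

lemma uN_of_notMem (P : Kernel X X) {A : Set X} (n : ℕ) {x : X} (hx : x ∉ A) :
    uN P A n x = 0 := by
  cases n <;> exact Set.indicator_of_notMem hx _

lemma uN_le_one (P : Kernel X X) [IsMarkovKernel P] (A : Set X) (n : ℕ) (x : X) :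
    uN P A n x ≤ 1 := by
  induction n generalizing x with
  | zero => exact Set.indicator_le_self' (fun _ _ => zero_le_one) x
  | succ n ih =>
    refine Set.indicator_apply_le' (fun _ => ?_) (fun _ => zero_le_one)
    calc ∫ y, uN P A n y ∂(P x) ≤ ∫ _, (1 : ℝ) ∂(P x) :=
          integral_mono_of_nonneg (.of_forall (uN_nonneg P A n)) (integrable_const 1)
            (.of_forall ih)
      _ = 1 := by simp

lemma uN_zero_eq_one_iff (P : Kernel X X) (A : Set X) (x : X) : uN P A 0 x = 1 ↔ x ∈ A := by
  by_cases hx : x ∈ A <;> simp [uN, hx]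

/-- The value function attains `1` at `x` iff `x ∈ A` and the chain started at `x` almost surely
jumps into the set where the previous value function attains `1`. -/
lemma uN_succ_eq_one_iff {P : Kernel X X} [IsMarkovKernel P] {A : Set X} {n : ℕ}
    (hu : Measurable (uN P A n)) (x : X) :
    uN P A (n + 1) x = 1 ↔ x ∈ A ∧ ∀ᵐ y ∂(P x), uN P A n y = 1 := by
  by_cases hx : x ∈ A
  · have hint : Integrable (uN P A n) (P x) :=
      .of_bound hu.aestronglyMeasurable 1 (.of_forall fun y => by
        rw [Real.norm_of_nonneg (uN_nonneg P A n y)]; exact uN_le_one P A n y)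
    have hsub : ∫ y, (1 - uN P A n y) ∂(P x) = 1 - ∫ y, uN P A n y ∂(P x) := by
      rw [integral_sub (integrable_const 1) hint]; simp
    have hzero := integral_eq_zero_iff_of_nonneg (μ := P x) (f := fun y => 1 - uN P A n y)
      (fun y => sub_nonneg.2 (uN_le_one P A n y)) ((integrable_const 1).sub hint)
    rw [hsub, sub_eq_zero, eq_comm] at hzero
    have hval : uN P A (n + 1) x = ∫ y, uN P A n y ∂(P x) := Set.indicator_of_mem hx _
    rw [hval, hzero]
    simp only [hx, true_and]
    refine Filter.eventually_congr (.of_forall fun y => ?_)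
    rw [Pi.zero_apply, sub_eq_zero, eq_comm]
  · simp [uN_of_notMem P _ hx, hx]

/-- A decreasing chain of iterates starting from a finite set is constant
after as many steps as the set has elements. -/
lemma iterate_eq_of_ncard_le {α : Type*} {F : Set α → Set α} {D : ℕ → Set α}
    (hD : Antitone D) (hF : ∀ n, D (n + 1) = F (D n)) (hfin : (D 0).Finite) {n : ℕ}
    (hn : (D 0).ncard ≤ n) : D n = D (D 0).ncard := by
  have hfin' (k : ℕ) : (D k).Finite := hfin.subset (hD (Nat.zero_le k))
  have hle {i j : ℕ} (h : i ≤ j) : (D j).ncard ≤ (D i).ncard :=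
    Set.ncard_le_ncard (hD h) (hfin' i)
  have hstab := Nat.stabilises_of_monotone (f := fun k => (D 0).ncard - (D k).ncard)
    (fun i j h => Nat.sub_le_sub_left (hle h) _) (fun _ => Nat.sub_le _ _)
    (fun k hk => by
      have h₀ := hle (Nat.zero_le k)
      have h₁ := hle (Nat.le_succ k)
      have hkk : D (k + 1) = D k :=
        Set.eq_of_subset_of_ncard_le (hD (Nat.le_succ k)) (by omega) (hfin' k)
      have : D (k + 2) = D (k + 1) := by rw [hF (k + 1), hkk, ← hF k, hkk]
      simp only [this]) hn
  have h₀ := hle (Nat.zero_le (D 0).ncard)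
  exact Set.eq_of_subset_of_ncard_le (hD hn) (by omega) (hfin' _)

lemma iSup_uN_lt_one_iff (P : Kernel X X) [IsMarkovKernel P] {A : Set X} (hA : A.Finite) (n : ℕ) :
    (⨆ x, uN P A n x) < 1 ↔ {x | uN P A n x = 1} = ∅ := by
  have hbdd : BddAbove (Set.range (uN P A n)) := ⟨1, by rintro _ ⟨x, rfl⟩; exact uN_le_one P A n x⟩
  constructor
  · intro h
    refine Set.eq_empty_of_forall_notMem fun x hx => ?_
    exact absurd (le_ciSup hbdd x) (by rw [show uN P A n x = 1 from hx]; exact not_le.2 h)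
  · intro h
    have hrange : (Set.range (uN P A n)).Finite :=
      ((hA.image (uN P A n)).insert 0).subset (by
        rintro _ ⟨x, rfl⟩
        by_cases hx : x ∈ A
        · exact Or.inr ⟨x, hx, rfl⟩
        · exact Or.inl (uN_of_notMem P n hx))
    rcases isEmpty_or_nonempty X with _ | _
    · simp
    · obtain ⟨x, hx⟩ := (Set.range_nonempty (uN P A n)).csSup_mem hrange
      rw [iSup, ← hx]
      exact lt_of_le_of_ne (uN_le_one P A n x) fun h' => h.subset h'

lemma uFun_eq_one_iff (P : Kernel X X) [IsMarkovKernel P] (A : Set X) (x : X) :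
    uFun P A x = 1 ↔ ∀ n, uN P A n x = 1 := by
  constructor
  · intro h n
    refine le_antisymm (uN_le_one P A n x) (h ▸ ciInf_le ⟨0, ?_⟩ n)
    rintro _ ⟨k, rfl⟩
    exact uN_nonneg P A k x
  · intro h
    simp [uFun, h]

lemma antitone_setOf_uN_eq_one {P : Kernel X X} [IsMarkovKernel P] {A : Set X}
    (hu : ∀ n, Measurable (uN P A n)) : Antitone fun n => {x | uN P A n x = 1} := by
  refine antitone_nat_of_succ_le fun n => ?_
  induction n with
  | zero =>
    exact fun x hx => (uN_zero_eq_one_iff P A x).2 ((uN_succ_eq_one_iff (hu 0) x).1 hx).1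
  | succ n ih =>
    intro x hx
    obtain ⟨hxA, hae⟩ := (uN_succ_eq_one_iff (hu (n + 1)) x).1 hx
    exact (uN_succ_eq_one_iff (hu n) x).2 ⟨hxA, hae.mono fun _ hy => ih hy⟩

/-- for a Markov chain on a countable discrete state space and a finite set `A`:
(a) if `m(A) < ∞` then `m(A) ≤ card(A)`; (b) consequently, if
`sup_i u_{card(A)+1}(i;A) = 1` then `m(A) = ∞` and
`l.a.s.(A) = {i : u_{card(A)+1}(i;A) = 1}`. -/
theorem stmt19 {X : Type*} [MeasurableSpace X] [MeasurableSingletonClass X] [Countable X]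
    (hdisc : ∀ S : Set X, MeasurableSet S)
    (P : Kernel X X) [IsMarkovKernel P] (A : Set X) (hAfin : A.Finite) :
    ({k : ℕ | (⨆ x, uN P A k x) < 1}.Nonempty →
        sInf {k : ℕ | (⨆ x, uN P A k x) < 1} ≤ A.ncard) ∧
      ((⨆ x, uN P A (A.ncard + 1) x) = 1 →
        {k : ℕ | (⨆ x, uN P A k x) < 1} = ∅ ∧
          {x | uFun P A x = 1} = {x | uN P A (A.ncard + 1) x = 1}) := by
  have hu (n : ℕ) : Measurable (uN P A n) := fun _ _ => hdisc _
  have hD := antitone_setOf_uN_eq_one hu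
  have hzero : {x | uN P A 0 x = 1} = A := Set.ext (uN_zero_eq_one_iff P A)
  have hstab {n : ℕ} (hn : A.ncard ≤ n) :
      {x | uN P A n x = 1} = {x | uN P A A.ncard x = 1} := by
    have := iterate_eq_of_ncard_le (F := fun S => {x | x ∈ A ∧ ∀ᵐ y ∂(P x), y ∈ S}) hD
      (fun k => Set.ext (uN_succ_eq_one_iff (hu k))) (by rwa [hzero]) (n := n) (by rwa [hzero])
    simpa only [hzero] using this
  have hanti (k : ℕ) : {x | uN P A A.ncard x = 1} ⊆ {x | uN P A k x = 1} := by
    rcases le_total k A.ncard with h | h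
    · exact hD h
    · exact (hstab h).ge
  simp only [iSup_uN_lt_one_iff P hAfin]
  refine ⟨fun ⟨k, hk⟩ => Nat.sInf_le (Set.subset_eq_empty (hanti k) hk), fun hsup => ⟨?_, ?_⟩⟩
  · refine Set.eq_empty_of_forall_notMem fun k hk => ?_
    have hempty : {x | uN P A (A.ncard + 1) x = 1} = ∅ := by
      rw [hstab (Nat.le_succ _)]
      exact Set.subset_eq_empty (hanti k) hk
    exact ((iSup_uN_lt_one_iff P hAfin _).2 hempty).ne hsup
  · ext x
    rw [Set.mem_ofPred_eq, uFun_eq_one_iff, hstab (Nat.le_succ _)]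
    exact ⟨fun h => h _, fun h k => hanti k h⟩
end
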